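/- Let d ≥ 1 and n ≥ 1 be integers, let t ≥ 1 be a real number, and let F be a finite family of convex sets in ℝ^d. If the intersection of every subfamily of F with at most 2d members contains a t-thick axis-parallel box with at least n lattice points, then the intersection of all members of F contains a t-thick axis-parallel box with at least n/(1 + 2/⌊t⌋)^d lattice points. -/

import Mathlib

/-- The number of lattice points (points of `ℤ^d`) in the axis-parallel box
`bx(x,y) = ∏ [xᵢ, yᵢ]`, realized as `Set.Icc x y` in `Fin d → ℝ`. -/
noncomputable def latticeCount {d : ℕ} (x y : Fin d → ℝ) : ℕ :=
  (Set.Icc x y ∩ {z : Fin d → ℝ | ∀ i, ∃ m : ℤ, z i = (m : ℝ)}).ncard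

theorem latticeCount_eq_prod {d : ℕ} (x y : Fin d → ℝ) :
    latticeCount x y = ∏ i, (⌊y i⌋ + 1 - ⌈x i⌉).toNat := by
  have himage : Set.Icc x y ∩ {z : Fin d → ℝ | ∀ i, ∃ m : ℤ, z i = (m : ℝ)} =
      (fun (m : Fin d → ℤ) i ↦ (m i : ℝ)) ''
        (Finset.Icc (fun i ↦ ⌈x i⌉) (fun i ↦ ⌊y i⌋) : Finset (Fin d → ℤ)) := by
    ext z
    simp only [Set.mem_inter_iff, Set.mem_Icc, Set.mem_ofPred_eq, Set.mem_image, Finset.mem_coe,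
      Finset.mem_Icc, Pi.le_def, Int.ceil_le, Int.le_floor]
    constructor
    · rintro ⟨⟨hx, hy⟩, hz⟩
      choose m hm using hz
      exact ⟨m, ⟨fun i ↦ hm i ▸ hx i, fun i ↦ hm i ▸ hy i⟩, funext fun i ↦ (hm i).symm⟩
    · rintro ⟨m, ⟨hx, hy⟩, rfl⟩
      exact ⟨⟨hx, hy⟩, fun i ↦ ⟨m i, rfl⟩⟩
  have hinj : Function.Injective (fun (m : Fin d → ℤ) i ↦ (m i : ℝ)) := fun a b h ↦
    funext fun i ↦ Int.cast_injective (congrFun h i)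
  rw [latticeCount, himage, Set.ncard_image_of_injective _ hinj, Set.ncard_coe_finset,
    Pi.card_Icc]
  simp

theorem latticeCount_le_prod_add_one {d : ℕ} {x y : Fin d → ℝ} (hxy : x ≤ y) :
    (latticeCount x y : ℝ) ≤ ∏ i, (y i - x i + 1) := by
  rw [latticeCount_eq_prod, Nat.cast_prod]
  refine Finset.prod_le_prod (fun _ _ ↦ Nat.cast_nonneg _) fun i _ ↦ ?_
  rw [← Int.cast_natCast (R := ℝ), Int.toNat_eq_max, Int.cast_max, max_le_iff]
  push_cast
  constructor <;> linarith [hxy i, Int.floor_le (y i), Int.le_ceil (x i)]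

theorem prod_add_one_le_latticeCount_mul {d : ℕ} {t : ℝ} (ht : 1 ≤ t) {x y : Fin d → ℝ}
    (hxy : ∀ i, t ≤ y i - x i) :
    ∏ i, (y i - x i + 1) ≤ latticeCount x y * (1 + 2 / (⌊t⌋ : ℝ)) ^ d := by
  have hpow : (1 + 2 / (⌊t⌋ : ℝ)) ^ d = ∏ _i : Fin d, (1 + 2 / (⌊t⌋ : ℝ)) := by simp
  rw [latticeCount_eq_prod, Nat.cast_prod, hpow, ← Finset.prod_mul_distrib]
  refine Finset.prod_le_prod (fun i _ ↦ by linarith [hxy i]) fun i _ ↦ ?_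
  have hfloor : (0 : ℝ) < ⌊t⌋ := by
    exact_mod_cast lt_of_lt_of_le one_pos (Int.le_floor.2 (by simpa using ht))
  have hy := Int.lt_floor_add_one (y i)
  have hx := Int.ceil_lt_add_one (x i)
  have hN : ⌊t⌋ ≤ ⌊y i⌋ + 1 - ⌈x i⌉ := by
    have : (⌊t⌋ : ℝ) < ((⌊y i⌋ + 1 - ⌈x i⌉ + 1 : ℤ) : ℝ) := by
      push_cast
      linarith [hxy i, Int.floor_le t]
    have := Int.cast_lt.1 this
    lia
  have hle : ((⌊y i⌋ + 1 - ⌈x i⌉ : ℤ) : ℝ) ≤ ((⌊y i⌋ + 1 - ⌈x i⌉).toNat : ℝ) := by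
    exact_mod_cast Int.self_le_toNat _
  have hNt : (⌊t⌋ : ℝ) ≤ ((⌊y i⌋ + 1 - ⌈x i⌉).toNat : ℝ) := (Int.cast_le.2 hN).trans hle
  have hdiv : 2 ≤ ((⌊y i⌋ + 1 - ⌈x i⌉).toNat : ℝ) * (2 / ⌊t⌋) := by
    rw [mul_div_assoc', le_div_iff₀ hfloor]
    linarith
  push_cast at hle
  linarith

theorem convex_setOf_le_prod {ι : Type*} [Fintype ι] {c : ℝ} (hc : 0 < c) :
    Convex ℝ {p : ι → ℝ | (∀ i, 0 < p i) ∧ c ≤ ∏ i, p i} := by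
  rintro p ⟨hp, hcp⟩ q ⟨hq, hcq⟩ a b ha hb hab
  refine ⟨fun i ↦ convex_Ioi (0 : ℝ) (hp i) (hq i) ha hb hab, ?_⟩
  calc c = c ^ a * c ^ b := by rw [← Real.rpow_add hc, hab, Real.rpow_one]
    _ ≤ (∏ i, p i) ^ a * (∏ i, q i) ^ b :=
      mul_le_mul (Real.rpow_le_rpow hc.le hcp ha) (Real.rpow_le_rpow hc.le hcq hb)
        (Real.rpow_nonneg hc.le _) (Real.rpow_nonneg (hc.le.trans hcp) _)
    _ = ∏ i, p i ^ a * q i ^ b := by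
      rw [Finset.prod_mul_distrib, Real.finsetProd_rpow _ _ fun i _ ↦ (hp i).le,
        Real.finsetProd_rpow _ _ fun i _ ↦ (hq i).le]
    _ ≤ ∏ i, (a • p + b • q) i := by
      refine Finset.prod_le_prod (fun i _ ↦ ?_) fun i _ ↦ ?_
      · exact mul_nonneg (Real.rpow_nonneg (hp i).le _) (Real.rpow_nonneg (hq i).le _)
      · exact Real.geom_mean_le_arith_mean2_weighted ha hb (hp i).le (hq i).le hab

theorem Convex.convex_setOf_Icc_subset {ι : Type*} {A : Set (ι → ℝ)} (hA : Convex ℝ A) :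
    Convex ℝ {p : (ι → ℝ) × (ι → ℝ) | p.1 ≤ p.2 ∧ Set.Icc p.1 p.2 ⊆ A} := by
  rintro p ⟨hp, hpA⟩ q ⟨hq, hqA⟩ a b ha hb hab
  have hle : (a • p + b • q).1 ≤ (a • p + b • q).2 :=
    add_le_add (smul_le_smul_of_nonneg_left hp ha) (smul_le_smul_of_nonneg_left hq hb)
  refine ⟨hle, fun z hz ↦ ?_⟩
  have hseg (i : ι) : z i ∈ segment ℝ ((a • p + b • q).1 i) ((a • p + b • q).2 i) := by
    rw [segment_eq_Icc (hle i)]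
    exact ⟨hz.1 i, hz.2 i⟩
  choose r s hr hs hrs hz using hseg
  have hmem {w : (ι → ℝ) × (ι → ℝ)} (hw : w.1 ≤ w.2) :
      (fun i ↦ r i • w.1 i + s i • w.2 i) ∈ Set.Icc w.1 w.2 := by
    have h (i : ι) : r i • w.1 i + s i • w.2 i ∈ Set.Icc (w.1 i) (w.2 i) :=
      convex_Icc _ _ (Set.left_mem_Icc.2 (hw i)) (Set.right_mem_Icc.2 (hw i)) (hr i) (hs i) (hrs i)
    exact ⟨fun i ↦ (h i).1, fun i ↦ (h i).2⟩
  convert hA (hpA (hmem hp)) (hqA (hmem hq)) ha hb hab using 1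
  ext i
  rw [← hz i]
  simp only [Prod.fst_add, Prod.snd_add, Prod.smul_fst, Prod.smul_snd, Pi.add_apply,
    Pi.smul_apply, smul_eq_mul]
  ring

/-- The endpoint pairs of the `t`-thick boxes inside `A` whose edge lengths `ℓ i` satisfy
`c ≤ ∏ i, (ℓ i + 1)`. -/
def thickBoxes {d : ℕ} (t c : ℝ) (A : Set (Fin d → ℝ)) : Set ((Fin d → ℝ) × (Fin d → ℝ)) :=
  {p | (∀ i, t ≤ p.2 i - p.1 i) ∧ Set.Icc p.1 p.2 ⊆ A ∧ c ≤ ∏ i, (p.2 i - p.1 i + 1)}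

theorem Convex.thickBoxes {d : ℕ} {t c : ℝ} (ht : 0 ≤ t) (hc : 0 < c) {A : Set (Fin d → ℝ)}
    (hA : Convex ℝ A) : Convex ℝ (thickBoxes t c A) := by
  rintro p ⟨hpt, hpA, hpc⟩ q ⟨hqt, hqA, hqc⟩ a b ha hb hab
  have hlen (i : Fin d) : (a • p + b • q).2 i - (a • p + b • q).1 i =
      a • (p.2 i - p.1 i) + b • (q.2 i - q.1 i) := by
    simp only [Prod.fst_add, Prod.snd_add, Prod.smul_fst, Prod.smul_snd, Pi.add_apply,
      Pi.smul_apply, smul_eq_mul]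
    ring
  refine ⟨fun i ↦ ?_, ?_, ?_⟩
  · rw [hlen]
    exact convex_Ici t (hpt i) (hqt i) ha hb hab
  · exact (hA.convex_setOf_Icc_subset ⟨fun i ↦ by linarith [hpt i], hpA⟩
      ⟨fun i ↦ by linarith [hqt i], hqA⟩ ha hb hab).2
  · refine (convex_setOf_le_prod hc ⟨fun i ↦ by linarith [hpt i], hpc⟩
      ⟨fun i ↦ by linarith [hqt i], hqc⟩ ha hb hab).2.trans_eq ?_
    refine Finset.prod_congr rfl fun i _ ↦ ?_
    rw [hlen]
    simp only [Pi.add_apply, Pi.smul_apply, smul_eq_mul]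
    linear_combination hab

/-- The `2d` Helly theorem for thick boxes: the set of boxes is projected along the direction of
uniform dilation, which lowers the dimension of the endpoint space to `2d - 1`. -/
theorem exists_mem_thickBoxes_of_card_le {d : ℕ} (hd : 1 ≤ d) {t c : ℝ} (ht : 0 ≤ t) (hc : 0 < c)
    {F : Finset (Set (Fin d → ℝ))} (hF : F.Nonempty) (hconv : ∀ A ∈ F, Convex ℝ A)
    (hloc : ∀ G ⊆ F, G.card ≤ 2 * d → ∃ p, ∀ A ∈ G, p ∈ thickBoxes t c A) :
    ∃ p, ∀ A ∈ F, p ∈ thickBoxes t c A := by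
  let v : (Fin d → ℝ) × (Fin d → ℝ) := (-1, 1)
  have hv : v ≠ 0 := fun h ↦
    one_ne_zero (α := ℝ) (congrFun (congrArg Prod.snd h) ⟨0, hd⟩)
  let π := (ℝ ∙ v).mkQ
  have hrank : Module.finrank ℝ (((Fin d → ℝ) × (Fin d → ℝ)) ⧸ (ℝ ∙ v)) + 1 = 2 * d := by
    have h := (ℝ ∙ v).finrank_quotient_add_finrank
    rw [finrank_span_singleton hv, Module.finrank_prod, Module.finrank_fin_fun] at h
    lia
  obtain ⟨w, hw⟩ := Convex.helly_theorem' (𝕜 := ℝ) (F := fun A ↦ π '' thickBoxes t c A) (s := F)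
    (fun A hA ↦ ((hconv A hA).thickBoxes ht hc).linear_image π) fun G hG hcard ↦ by
      obtain ⟨p, hp⟩ := hloc G hG (hrank ▸ hcard)
      exact ⟨π p, Set.mem_iInter₂.2 fun A hA ↦ ⟨p, hp A hA, rfl⟩⟩
  obtain ⟨p₀, rfl⟩ := (ℝ ∙ v).mkQ_surjective w
  have hfiber : ∀ A ∈ F, ∃ s : ℝ, p₀ + s • v ∈ thickBoxes t c A := fun A hA ↦ by
    obtain ⟨p, hp, hpw⟩ := Set.mem_iInter₂.1 hw A hA
    obtain ⟨s, hs⟩ := Submodule.mem_span_singleton.1 ((Submodule.Quotient.eq _).1 hpw)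
    exact ⟨s, by rwa [hs, add_sub_cancel]⟩
  choose! s hs using hfiber
  obtain ⟨B, hB, hmin⟩ := F.exists_min_image s hF
  refine ⟨p₀ + s B • v, fun A hA ↦ ⟨(hs B hB).1, ?_, (hs B hB).2.2⟩⟩
  refine (Set.Icc_subset_Icc (fun i ↦ ?_) fun i ↦ ?_).trans (hs A hA).2.1
  all_goals
    have := hmin A hA
    simp [v]
    linarith

/-- If every subfamily of at most `2d` members of a finite family of convex sets in `ℝ^d`
has a `t`-thick axis-parallel box with at least `n` lattice points in its intersection,
then the intersection of the whole family contains a `t`-thick axis-parallel box with at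
least `n / (1 + 2/⌊t⌋)^d` lattice points. -/
theorem fractional_box_helly_m_eq_d (d n : ℕ) (hd : 1 ≤ d) (hn : 1 ≤ n)
    (t : ℝ) (ht : 1 ≤ t)
    (F : Finset (Set (Fin d → ℝ))) (hconv : ∀ A ∈ F, Convex ℝ A)
    (hloc : ∀ G ⊆ F, G.card ≤ 2 * d →
      ∃ x y : Fin d → ℝ, x ≤ y ∧ (∀ i, t ≤ y i - x i) ∧
        (∀ A ∈ G, Set.Icc x y ⊆ A) ∧ n ≤ latticeCount x y) :
    ∃ x y : Fin d → ℝ, x ≤ y ∧ (∀ i, t ≤ y i - x i) ∧ (∀ A ∈ F, Set.Icc x y ⊆ A) ∧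
      (n : ℝ) / (1 + 2 / (⌊t⌋ : ℝ)) ^ d ≤ (latticeCount x y : ℝ) := by
  rcases F.eq_empty_or_nonempty with rfl | hF
  · obtain ⟨x, y, hxy, hthick, -, hcount⟩ := hloc ∅ subset_rfl (by simp)
    refine ⟨x, y, hxy, hthick, by simp, ?_⟩
    have hfloor : (0 : ℝ) ≤ ⌊t⌋ := by exact_mod_cast Int.floor_nonneg.2 (zero_le_one.trans ht)
    have hone : (1 : ℝ) ≤ 1 + 2 / (⌊t⌋ : ℝ) := le_add_of_nonneg_right (by positivity)
    exact (div_le_self n.cast_nonneg (one_le_pow₀ hone)).trans (by exact_mod_cast hcount)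
  · obtain ⟨⟨x, y⟩, hp⟩ := exists_mem_thickBoxes_of_card_le hd (zero_le_one.trans ht)
      (c := n) (by exact_mod_cast hn) hF hconv fun G hG hcard ↦ by
        obtain ⟨x, y, hxy, hthick, hsub, hcount⟩ := hloc G hG hcard
        exact ⟨(x, y), fun A hA ↦ ⟨hthick, hsub A hA,
          (Nat.cast_le.2 hcount).trans (latticeCount_le_prod_add_one hxy)⟩⟩
    obtain ⟨B, hB⟩ := hF
    obtain ⟨hthick, -, hprod⟩ := hp B hB
    refine ⟨x, y, fun i ↦ by linarith [hthick i], hthick, fun A hA ↦ (hp A hA).2.1, ?_⟩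
    have hfloor : (0 : ℝ) ≤ ⌊t⌋ := by exact_mod_cast Int.floor_nonneg.2 (zero_le_one.trans ht)
    rw [div_le_iff₀ (by positivity)]
    exact hprod.trans (prod_add_one_le_latticeCount_mul ht hthick)
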